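/- arXiv:0907.4276 — 2 statements merged into one kernel-verified Lean document; each statement's English description precedes it below -/
import Mathlib

section
/- Let (X,r) be a square-free solution of arbitrary cardinality with abelian permutation group G(X,r), and suppose X has exactly t ≥ 1 orbits under G(X,r). Then (X,r) is a multipermutation solution with mpl(X,r) ≤ t. -/
namespace YBPaper

variable {X : Type*}

/-- Left translation: `lact r x y = ˣy`. -/
def lact (r : X × X → X × X) (x y : X) : X := (r (x, y)).1

/-- Right translation: `ract r x y = xʸ`. -/
def ract (r : X × X → X × X) (x y : X) : X := (r (x, y)).2

def r12 (r : X × X → X × X) : X × X × X → X × X × X :=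
  fun p => ((r (p.1, p.2.1)).1, (r (p.1, p.2.1)).2, p.2.2)

def r23 (r : X × X → X × X) : X × X × X → X × X × X :=
  fun p => (p.1, r (p.2.1, p.2.2))

/-- A non-degenerate involutive square-free set-theoretic solution of the YBE. -/
structure IsSquareFreeSolution (r : X × X → X × X) : Prop where
  nondegL : ∀ x : X, Function.Bijective fun y => (r (x, y)).1
  nondegR : ∀ y : X, Function.Bijective fun x => (r (x, y)).2
  invol : ∀ p : X × X, r (r p) = p
  sqfree : ∀ x : X, r (x, x) = (x, x)
  braided : ∀ p : X × X × X, r12 r (r23 r (r12 r p)) = r23 r (r12 r (r23 r p))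

/-- `relk l k x y` means the images of `x` and `y` in the `k`-th retract coincide. -/
def relk (l : X → X → X) : ℕ → X → X → Prop
  | 0 => fun x y => x = y
  | (k+1) => fun x y => ∀ z : X, relk l k (l x z) (l y z)

/-- `mplLe l m` : the `m`-th retract is a one-element solution, i.e. `mpl ≤ m`. -/
def mplLe (l : X → X → X) (m : ℕ) : Prop := ∀ x y : X, relk l m x y

/-- `mplEq l m` : the multipermutation level is exactly `m`. -/
def mplEq (l : X → X → X) (m : ℕ) : Prop := mplLe l m ∧ ∀ k < m, ¬ mplLe l k

/-- The set of left translations, as permutations. -/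
def lperms (r : X × X → X × X) : Set (Equiv.Perm X) :=
  {σ : Equiv.Perm X | ∃ x : X, ∀ y : X, σ y = (r (x, y)).1}

/-- The YB permutation group `𝒢(X,r)`, generated by the left translations. -/
def Gcal (r : X × X → X × X) : Subgroup (Equiv.Perm X) := Subgroup.closure (lperms r)

/-- The left translation `L_x` as a permutation. -/
noncomputable def leftPerm {r : X × X → X × X} (h : IsSquareFreeSolution r) (x : X) :
    Equiv.Perm X :=
  Equiv.ofBijective _ (h.nondegL x)

/-- The set of orbits of `X` under the permutation group. -/
abbrev Orbits (r : X × X → X × X) : Type _ :=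
  Quotient (MulAction.orbitRel (↥(Gcal r)) X)

/-- The orbit of a point under the permutation group. -/
def orbitOf (r : X × X → X × X) (x : X) : Orbits r := Quotient.mk _ x

/-- The subgroup of the permutation group generated by the left translations by the elements of
one orbit. -/
def orbitSubgroup {r : X × X → X × X} (h : IsSquareFreeSolution r) (q : Orbits r) :
    Subgroup (Equiv.Perm X) :=
  Subgroup.closure {σ | ∃ u, orbitOf r u = q ∧ leftPerm h u = σ}

theorem relk_refl (l : X → X → X) (k : ℕ) (x : X) : relk l k x x := by
  induction k generalizing x with
  | zero => rfl
  | succ k ih => exact fun z => ih _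

theorem relk_symm {l : X → X → X} {k : ℕ} {x y : X} (hxy : relk l k x y) : relk l k y x := by
  induction k generalizing x y with
  | zero => exact Eq.symm hxy
  | succ k ih => exact fun z => ih (hxy z)

theorem relk_trans {l : X → X → X} {k : ℕ} {x y z : X} (hxy : relk l k x y)
    (hyz : relk l k y z) : relk l k x z := by
  induction k generalizing x y z with
  | zero => exact Eq.trans hxy hyz
  | succ k ih => exact fun w => ih (hxy w) (hyz w)

section

variable {r : X × X → X × X} (h : IsSquareFreeSolution r)

theorem leftPerm_mem_Gcal (x : X) : leftPerm h x ∈ Gcal r :=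
  Subgroup.subset_closure ⟨x, fun _ => rfl⟩

theorem orbitOf_apply {σ : Equiv.Perm X} (hσ : σ ∈ Gcal r) (x : X) :
    orbitOf r (σ x) = orbitOf r x :=
  Quotient.sound (s := MulAction.orbitRel (↥(Gcal r)) X) ⟨⟨σ, hσ⟩, rfl⟩

theorem leftPerm_self (x : X) : leftPerm h x x = x :=
  congrArg Prod.fst (h.sqfree x)

theorem leftPerm_mul_leftPerm (x y : X) :
    leftPerm h x * leftPerm h y =
      leftPerm h (leftPerm h x y) * leftPerm h ((leftPerm h (leftPerm h x y))⁻¹ x) := by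
  have hx : (leftPerm h (leftPerm h x y))⁻¹ x = (r (x, y)).2 := by
    rw [Equiv.Perm.inv_eq_iff_eq]
    exact (congrArg Prod.fst (h.invol (x, y))).symm
  rw [hx]
  ext z
  exact (congrArg Prod.fst (h.braided (x, y, z))).symm

theorem leftPerm_mem_orbitSubgroup {q : Orbits r} {u : X} (hu : orbitOf r u = q) :
    leftPerm h u ∈ orbitSubgroup h q :=
  Subgroup.subset_closure ⟨u, hu, rfl⟩

/-- Points of the same orbit have left translations that differ by an element of the subgroup
attached to that orbit. -/
theorem leftPerm_mul_inv_mem_of_orbitOf_eq {q : Orbits r} {x y : X} (hx : orbitOf r x = q)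
    (hy : orbitOf r y = q) : leftPerm h y * (leftPerm h x)⁻¹ ∈ orbitSubgroup h q :=
  mul_mem (leftPerm_mem_orbitSubgroup h hy) (inv_mem (leftPerm_mem_orbitSubgroup h hx))

theorem leftPerm_apply_of_orbitOf_eq
    (hab : ∀ σ ∈ Gcal r, ∀ τ ∈ Gcal r, σ * τ = τ * σ)
    {u z : X} (huz : orbitOf r z = orbitOf r u) :
    leftPerm h u z = z := by
  obtain ⟨⟨g, hg⟩, rfl⟩ : z ∈ MulAction.orbit (↥(Gcal r)) u := Quotient.exact huz
  have hcomm := congrArg (fun σ : Equiv.Perm X => σ u) (hab _ (leftPerm_mem_Gcal h u) g hg)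
  simpa [Equiv.Perm.mul_apply, leftPerm_self] using hcomm

/-- The subgroup attached to an orbit fixes that orbit pointwise. -/
theorem apply_eq_of_mem_orbitSubgroup
    (hab : ∀ σ ∈ Gcal r, ∀ τ ∈ Gcal r, σ * τ = τ * σ)
    {q : Orbits r} {σ : Equiv.Perm X}
    (hσ : σ ∈ orbitSubgroup h q) {z : X} (hz : orbitOf r z = q) : σ z = z := by
  induction hσ using Subgroup.closure_induction with
  | mem σ hσ =>
    obtain ⟨u, hu, rfl⟩ := hσ
    exact leftPerm_apply_of_orbitOf_eq h hab (hz.trans hu.symm)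
  | one => rfl
  | mul σ τ _ _ h₁ h₂ => rw [Equiv.Perm.mul_apply, h₂, h₁]
  | inv σ _ h₁ => rw [Equiv.Perm.inv_eq_iff_eq, h₁]

/-- Moving a point by the subgroup attached to an orbit changes its left translation by an
element of this subgroup. -/
theorem leftPerm_apply_mul_inv_mem
    (hab : ∀ σ ∈ Gcal r, ∀ τ ∈ Gcal r, σ * τ = τ * σ)
    {q : Orbits r} {σ : Equiv.Perm X}
    (hσ : σ ∈ orbitSubgroup h q) (a : X) :
    leftPerm h (σ a) * (leftPerm h a)⁻¹ ∈ orbitSubgroup h q := by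
  induction hσ using Subgroup.closure_induction generalizing a with
  | mem σ hσ =>
    obtain ⟨u, hu, rfl⟩ := hσ
    set b := leftPerm h u a with hb
    set v := (leftPerm h b)⁻¹ u with hv
    have hvq : orbitOf r v = q :=
      (orbitOf_apply (inv_mem (leftPerm_mem_Gcal h b)) u).trans hu
    have hyb : leftPerm h u * leftPerm h a = leftPerm h b * leftPerm h v :=
      leftPerm_mul_leftPerm h u a
    have hcomm := hab _ (leftPerm_mem_Gcal h a) _ (inv_mem (leftPerm_mem_Gcal h v))
    have key : leftPerm h b * (leftPerm h a)⁻¹ = leftPerm h u * (leftPerm h v)⁻¹ := by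
      rw [eq_mul_inv_of_mul_eq hyb.symm, mul_assoc (leftPerm h u), hcomm, ← mul_assoc,
        mul_inv_cancel_right]
    rw [key]
    exact mul_mem (leftPerm_mem_orbitSubgroup h hu) (inv_mem (leftPerm_mem_orbitSubgroup h hvq))
  | one => simp
  | mul σ τ _ _ h₁ h₂ =>
    simpa [mul_assoc] using mul_mem (h₁ (τ a)) (h₂ a)
  | inv σ _ h₁ => simpa using inv_mem (h₁ (σ⁻¹ a))

/-- If the left translations of `x` and `y` agree modulo the subgroups attached to all but fewer
than `k` orbits, then `x` and `y` coincide in the `k`-th retract. -/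
theorem relk_of_leftPerm_mul_inv_mem
    (hab : ∀ σ ∈ Gcal r, ∀ τ ∈ Gcal r, σ * τ = τ * σ)
    [Finite (Orbits r)] (k : ℕ) (A : Finset (Orbits r))
    (hA : Nat.card (Orbits r) < A.card + k) {x y : X}
    (hxy : ∀ q ∈ A, leftPerm h y * (leftPerm h x)⁻¹ ∈ orbitSubgroup h q) :
    relk (lact r) k x y := by
  classical
  have := Fintype.ofFinite (Orbits r)
  induction k generalizing A x y with
  | zero =>
    have := A.card_le_univ
    rw [Nat.card_eq_fintype_card] at hA
    omega
  | succ k ih =>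
    intro z
    change relk (lact r) k (leftPerm h x z) (leftPerm h y z)
    have hx := orbitOf_apply (leftPerm_mem_Gcal h x) z
    have hy := orbitOf_apply (leftPerm_mem_Gcal h y) z
    have hyz : leftPerm h y z = (leftPerm h y * (leftPerm h x)⁻¹) (leftPerm h x z) := by simp
    by_cases hz : orbitOf r z ∈ A
    · rw [hyz, apply_eq_of_mem_orbitSubgroup h hab (hxy _ hz) hx]
      exact relk_refl _ _ _
    · refine ih (insert (orbitOf r z) A) ?_ fun q hq => ?_
      · rw [Finset.card_insert_of_notMem hz]
        omega
      · rcases Finset.mem_insert.1 hq with rfl | hq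
        · exact leftPerm_mul_inv_mem_of_orbitOf_eq h hx hy
        · rw [hyz]
          exact leftPerm_apply_mul_inv_mem h hab (hxy q hq) _

/-- With `k + 1` orbits, every left translation is trivial on the `k`-th retract. -/
theorem relk_leftPerm_apply
    (hab : ∀ σ ∈ Gcal r, ∀ τ ∈ Gcal r, σ * τ = τ * σ)
    [Finite (Orbits r)] {k : ℕ} (hk : Nat.card (Orbits r) = k + 1)
    (x z : X) : relk (lact r) k z (leftPerm h x z) := by
  classical
  by_cases hxz : orbitOf r z = orbitOf r x
  · rw [leftPerm_apply_of_orbitOf_eq h hab hxz]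
    exact relk_refl _ _ _
  · refine relk_of_leftPerm_mul_inv_mem h hab k {orbitOf r z, orbitOf r x} ?_ fun q hq => ?_
    · rw [Finset.card_pair hxz]
      omega
    · rcases Finset.mem_insert.1 hq with rfl | hq
      · exact leftPerm_mul_inv_mem_of_orbitOf_eq h rfl (orbitOf_apply (leftPerm_mem_Gcal h x) z)
      · rw [Finset.mem_singleton.1 hq]
        exact leftPerm_apply_mul_inv_mem h hab (leftPerm_mem_orbitSubgroup h rfl) z

end

/-- a square-free solution with abelian permutation group and exactly
`t ≥ 1` orbits is a multipermutation solution with `mpl(X,r) ≤ t`. -/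
theorem stmt9 {X : Type*} (r : X × X → X × X) (h : IsSquareFreeSolution r)
    (hab : ∀ σ ∈ Gcal r, ∀ τ ∈ Gcal r, σ * τ = τ * σ)
    (t : ℕ) (ht : 1 ≤ t)
    (horb : Nat.card (Quotient (MulAction.orbitRel (↥(Gcal r)) X)) = t) :
    mplLe (lact r) t := by
  have : Finite (Orbits r) := Nat.finite_of_card_ne_zero (by rw [horb]; omega)
  obtain ⟨k, rfl⟩ : ∃ k, t = k + 1 := ⟨t - 1, by omega⟩
  exact fun x y z =>
    relk_trans (relk_symm (relk_leftPerm_apply h hab horb x z)) (relk_leftPerm_apply h hab horb y z)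

end YBPaper
end

section
/- Let (X,r) be a square-free solution of finite order with X nontrivial. Then the solvable length of the structure group G(X,r) equals the solvable length of the permutation group G(X,r) ⊆ Sym(X) plus one: sol(G(X,r)) = sol(𝒢(X,r)) + 1. -/
namespace YBPaper

variable {X : Type*}

/-- Relations of the structure group `G(X,r) = ⟨X ∣ xy = (ˣy)(xʸ)⟩`. -/
def structRels (r : X × X → X × X) : Set (FreeGroup X) :=
  {w | ∃ x y : X, w = FreeGroup.of x * FreeGroup.of y *
        (FreeGroup.of ((r (x, y)).1) * FreeGroup.of ((r (x, y)).2))⁻¹}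

/-- The solvable length of a group: the least `n` with `derivedSeries G n = ⊥`. -/
noncomputable def solLength (G : Type*) [Group G] : ℕ :=
  sInf {n : ℕ | derivedSeries G n = ⊥}

end YBPaper

section RootsOfUnity

open Polynomial

/-- An average of roots of unity that is an algebraic integer is zero or is attained by every
term. -/
theorem sum_eq_zero_or_eq_of_isIntegral_average {ι : Type*} [Fintype ι] [Nonempty ι] {ζ : ι → ℂ}
    {m : ℕ} (hm : 0 < m) (hζ : ∀ i, ζ i ^ m = 1)
    (havg : IsIntegral ℤ ((∑ i, ζ i) / Fintype.card ι)) :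
    ∑ i, ζ i = 0 ∨ ∃ μ, ∀ i, ζ i = μ := by
  classical
  have hcard : (Fintype.card ι : ℂ) ≠ 0 := by simp
  have hcardR : (0 : ℝ) < Fintype.card ι := by exact_mod_cast Fintype.card_pos
  by_cases h0 : ∑ i, ζ i = 0
  · exact Or.inl h0
  right
  let K := IntermediateField.adjoin ℚ (Set.range ζ)
  have hfin : FiniteDimensional ℚ K :=
    IntermediateField.finiteDimensional_adjoin (by
      rintro _ ⟨i, rfl⟩
      exact IsIntegral.of_pow hm (by rw [hζ]; exact isIntegral_one))
  have : NumberField K := ⟨⟩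
  let η : ι → K := fun i => ⟨ζ i, IntermediateField.subset_adjoin _ _ ⟨i, rfl⟩⟩
  have hη : ∀ i, η i ^ m = 1 := fun i => Subtype.ext (by simpa [η] using hζ i)
  let y : K := (∑ i, η i) / Fintype.card ι
  have hy : algebraMap K ℂ y = (∑ i, ζ i) / Fintype.card ι := by simp [y, η]
  have hy0 : y ≠ 0 := by
    intro h
    rw [h, map_zero] at hy
    exact div_ne_zero h0 hcard hy.symm
  have hyint : IsIntegral ℤ y := by
    rw [← isIntegral_algebraMap_iff (B := ℂ) (algebraMap K ℂ).injective]
    rw [hy]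
    exact havg
  obtain ⟨k, hk, hyk⟩ := NumberField.Embeddings.pow_eq_one_of_norm_le_one K ℂ hy0 hyint (by
    intro φ
    have h1 : ∀ i, ‖φ (η i)‖ = 1 := fun i =>
      Complex.norm_eq_one_of_pow_eq_one (by rw [← map_pow, hη, map_one]) hm.ne'
    have : φ y = (∑ i, φ (η i)) / Fintype.card ι := by simp [y]
    rw [this, norm_div, Complex.norm_natCast, div_le_one hcardR]
    refine (norm_sum_le _ _).trans ?_
    simp [h1])
  set α : ℂ := algebraMap K ℂ y
  have hα1 : ‖α‖ = 1 := Complex.norm_eq_one_of_pow_eq_one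
    (by simp only [α]; rw [← map_pow, hyk, map_one]) hk.ne'
  have hre : ∀ i, (ζ i * (starRingEnd ℂ) α).re ≤ 1 := fun i => by
    refine (Complex.re_le_norm _).trans ?_
    rw [norm_mul, RCLike.norm_conj, hα1, Complex.norm_eq_one_of_pow_eq_one (hζ i) hm.ne', one_mul]
  have hsum : ∑ i, (ζ i * (starRingEnd ℂ) α).re = ∑ _i : ι, (1 : ℝ) := by
    rw [← Complex.re_sum, ← Finset.sum_mul]
    have : ∑ i, ζ i = Fintype.card ι * α := by rw [hy]; field_simp
    rw [this, mul_assoc, Complex.mul_conj, Complex.normSq_eq_norm_sq, hα1]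
    simp
  have heq := (Finset.sum_eq_sum_iff_of_le fun i _ => hre i).1 hsum
  refine ⟨α, fun i => ?_⟩
  have hi := heq i (Finset.mem_univ i)
  have hn : ‖ζ i * (starRingEnd ℂ) α‖ = 1 := by
    rw [norm_mul, RCLike.norm_conj, hα1, Complex.norm_eq_one_of_pow_eq_one (hζ i) hm.ne', one_mul]
  have h1 : ζ i * (starRingEnd ℂ) α = 1 := by
    have hs := Complex.normSq_apply (ζ i * (starRingEnd ℂ) α)
    rw [Complex.normSq_eq_norm_sq, hn, hi] at hs
    refine Complex.ext (by simpa using hi) ?_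
    have : (ζ i * (starRingEnd ℂ) α).im * (ζ i * (starRingEnd ℂ) α).im = 0 := by linarith
    simpa using mul_self_eq_zero.1 this
  have h2 : (starRingEnd ℂ) α * α = 1 := by
    rw [mul_comm, Complex.mul_conj, Complex.normSq_eq_norm_sq, hα1]; simp
  calc ζ i = ζ i * ((starRingEnd ℂ) α * α) := by rw [h2, mul_one]
    _ = α := by rw [← mul_assoc, h1, one_mul]

theorem Matrix.pow_eq_one_of_mem_roots_charpoly {n : ℕ} {M : Matrix (Fin n) (Fin n) ℂ} {m : ℕ}
    (hM : M ^ m = 1) {z : ℂ} (hz : z ∈ M.charpoly.roots) : z ^ m = 1 := by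
  rw [Polynomial.mem_roots M.charpoly_monic.ne_zero, ← Matrix.mem_spectrum_iff_isRoot_charpoly] at hz
  have := spectrum.pow_mem_pow M m hz
  rw [hM] at this
  rcases isEmpty_or_nonempty (Fin n) with h | h
  · exact absurd this (by simp)
  · simpa using this

/-- If a complex matrix of finite order has normalised trace an algebraic integer, then it is scalar
or its trace vanishes. -/
theorem Matrix.trace_eq_zero_or_scalar {n : ℕ} [NeZero n] {M : Matrix (Fin n) (Fin n) ℂ} {m : ℕ}
    (hm : 0 < m) (hM : M ^ m = 1) (havg : IsIntegral ℤ (M.trace / n)) :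
    M.trace = 0 ∨ ∃ μ : ℂ, M = algebraMap ℂ _ μ := by
  have hroots : ∀ z ∈ M.charpoly.roots, z ^ m = 1 := fun z hz =>
    Matrix.pow_eq_one_of_mem_roots_charpoly hM hz
  have hcard : M.charpoly.roots.card = n := by
    rw [IsAlgClosed.card_roots_eq_natDegree, Matrix.charpoly_natDegree_eq_dim, Fintype.card_fin]
  have htr := Matrix.trace_eq_sum_roots_charpoly M
  obtain ⟨l, hl⟩ := Quot.exists_rep M.charpoly.roots
  change (l : Multiset ℂ) = _ at hl
  rw [← hl] at hroots hcard htr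
  simp only [Multiset.coe_card, Multiset.sum_coe] at hcard htr
  have hsum : ∑ i : Fin l.length, l.get i = M.trace := by
    rw [htr, ← List.sum_ofFn, List.ofFn_get]
  have : Nonempty (Fin l.length) := ⟨⟨0, by rw [hcard]; exact NeZero.pos n⟩⟩
  rcases sum_eq_zero_or_eq_of_isIntegral_average (ζ := l.get) hm
    (fun i => hroots _ (by simp)) (by rwa [hsum, Fintype.card_fin, hcard]) with h | ⟨μ, h⟩
  · exact Or.inl (hsum ▸ h)
  right
  refine ⟨μ, ?_⟩
  have hdvd : minpoly ℂ M ∣ X ^ m - C 1 := minpoly.dvd _ _ (by simp [hM])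
  have hsep : (X ^ m - C (1 : ℂ)).Separable :=
    separable_X_pow_sub_C 1 (by exact_mod_cast hm.ne') one_ne_zero
  have hdvd' : minpoly ℂ M ∣ X - C μ := by
    rw [IsAlgClosed.dvd_iff_roots_le_roots (minpoly.ne_zero (Matrix.isIntegral M))
      (X_sub_C_ne_zero μ), roots_X_sub_C]
    rw [Multiset.le_iff_subset (nodup_roots (hsep.of_dvd hdvd))]
    intro z hz
    have : z ∈ (l : Multiset ℂ) := by
      rw [hl]
      exact Multiset.mem_of_le (roots.le_of_dvd M.charpoly_monic.ne_zero
        (Matrix.minpoly_dvd_charpoly M)) hz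
    obtain ⟨i, rfl⟩ := List.get_of_mem (Multiset.mem_coe.1 this)
    simp [← h i]
  have := aeval_eq_zero_of_dvd_aeval_eq_zero hdvd' (minpoly.aeval ℂ M)
  simpa [sub_eq_zero] using this

end RootsOfUnity

theorem LinearMap.trace_mulLeft_pi_matrix {ι : Type*} [Fintype ι] [DecidableEq ι] {d : ι → ℕ}
    (M : ∀ i, Matrix (Fin (d i)) (Fin (d i)) ℂ) :
    LinearMap.trace ℂ _ (LinearMap.mulLeft ℂ M) = ∑ i, (d i : ℂ) * (M i).trace := by
  classical
  rw [LinearMap.trace_eq_matrix_trace ℂ (Pi.basis fun i => Matrix.stdBasis ℂ (Fin (d i)) (Fin (d i)))]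
  rw [Matrix.trace, Fintype.sum_sigma]
  refine Finset.sum_congr rfl fun i _ => ?_
  rw [Fintype.sum_prod_type]
  have : ∀ j k, Matrix.diag (LinearMap.toMatrix
      (Pi.basis fun i => Matrix.stdBasis ℂ (Fin (d i)) (Fin (d i)))
      (Pi.basis fun i => Matrix.stdBasis ℂ (Fin (d i)) (Fin (d i))) (LinearMap.mulLeft ℂ M))
      ⟨i, (j, k)⟩ = M i j j := by
    intro j k
    rw [Matrix.diag_apply, LinearMap.toMatrix_apply, Pi.basis_repr]
    have h : (M i * (Matrix.single j k 1 : Matrix (Fin (d i)) (Fin (d i)) ℂ)) j k = M i j j := by simp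
    simpa [Matrix.stdBasis_eq_single, Matrix.stdBasis, Matrix.single_eq_of_single_single] using h
  simp only [this, Matrix.trace, Matrix.diag_apply, Finset.mul_sum, Finset.sum_const, Finset.card_univ,
    Fintype.card_fin, nsmul_eq_mul]

theorem MonoidAlgebra.trace_mulLeft_single {G : Type*} [Group G] [Fintype G] {g : G}
    (hg : g ≠ 1) :
    LinearMap.trace ℂ _ (LinearMap.mulLeft ℂ (MonoidAlgebra.single g (1 : ℂ))) = 0 := by
  classical
  rw [LinearMap.trace_eq_matrix_trace ℂ (MonoidAlgebra.basis G ℂ), Matrix.trace]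
  refine Finset.sum_eq_zero fun h _ => ?_
  rw [Matrix.diag_apply, LinearMap.toMatrix_apply, MonoidAlgebra.basis_apply]
  simp [MonoidAlgebra.basis, MonoidAlgebra.single_mul_single, hg]

section Wedderburn

variable {G ι : Type*} [Group G] {d : ι → ℕ}
  (e : MonoidAlgebra ℂ G ≃ₐ[ℂ] ∀ i, Matrix (Fin (d i)) (Fin (d i)) ℂ)

/-- The representation of `G` on a Wedderburn component of its group algebra. -/
noncomputable def wedderburnRep (i : ι) : G →* Matrix (Fin (d i)) (Fin (d i)) ℂ :=
  ((Pi.evalMonoidHom (fun i => Matrix (Fin (d i)) (Fin (d i)) ℂ) i).comp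
    (e : MonoidAlgebra ℂ G →* ∀ i, Matrix (Fin (d i)) (Fin (d i)) ℂ)).comp (MonoidAlgebra.of ℂ G)

theorem wedderburnRep_apply (i : ι) (g : G) :
    wedderburnRep e i g = e (MonoidAlgebra.single g 1) i := rfl

theorem sum_mul_trace_wedderburnRep [Fintype G] [Fintype ι] {g : G} (hg : g ≠ 1) :
    ∑ i, (d i : ℂ) * (wedderburnRep e i g).trace = 0 := by
  classical
  simp_rw [wedderburnRep_apply]
  rw [← LinearMap.trace_mulLeft_pi_matrix, ← MonoidAlgebra.trace_mulLeft_single hg,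
    ← LinearMap.trace_conj' (LinearMap.mulLeft ℂ (MonoidAlgebra.single g (1 : ℂ))) e.toLinearEquiv]
  congr 1
  refine LinearMap.ext fun x => ?_
  simp [LinearEquiv.conj_apply]

theorem exists_scalar_of_central {c : MonoidAlgebra ℂ G}
    (hc : ∀ g, MonoidAlgebra.single g 1 * c = c * MonoidAlgebra.single g 1) (i : ι) :
    ∃ ω : ℂ, e c i = algebraMap ℂ _ ω := by
  classical
  have hc' : ∀ x, x * c = c * x := by
    intro x
    induction x using MonoidAlgebra.induction_on with
    | of g => exact hc g
    | add x y hx hy => rw [add_mul, mul_add, hx, hy]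
    | smul r x hx => rw [smul_mul_assoc, mul_smul_comm, hx]
  have hmem : e c i ∈ Subalgebra.center ℂ (Matrix (Fin (d i)) (Fin (d i)) ℂ) := by
    rw [Subalgebra.mem_center_iff]
    intro b
    have := congrArg (fun y => e y i) (hc' (e.symm (Pi.single i b)))
    simpa using this
  rw [Algebra.IsCentral.center_eq_bot, Algebra.mem_bot] at hmem
  obtain ⟨ω, h⟩ := hmem
  exact ⟨ω, h.symm⟩

theorem Matrix.isIntegral_trace_of_pow_eq_one {n m : ℕ} {M : Matrix (Fin n) (Fin n) ℂ}
    (hm : 0 < m) (hM : M ^ m = 1) : IsIntegral ℤ M.trace := by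
  rw [Matrix.trace_eq_sum_roots_charpoly]
  exact IsIntegral.multiset_sum fun z hz => IsIntegral.of_pow hm (by
    rw [Matrix.pow_eq_one_of_mem_roots_charpoly hM hz]; exact isIntegral_one)

/-- The sum of a conjugacy class is integral in the group algebra, so it acts on each component as
an algebraic integer. -/
theorem isIntegral_card_mul_trace_div [Fintype G] (i : ι) [NeZero (d i)] (z : G) :
    IsIntegral ℤ ((Nat.card (conjugatesOf z) : ℂ) * (wedderburnRep e i z).trace / d i) := by
  classical
  have key : ∀ x, x ∈ (conjugatesOf z).toFinset ↔ IsConj z x := fun x => Set.mem_toFinset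
  let c : MonoidAlgebra ℂ G := ∑ g ∈ (conjugatesOf z).toFinset, MonoidAlgebra.single g 1
  obtain ⟨ω, hω⟩ := exists_scalar_of_central e (c := c) (fun g => by
    simp only [c, Finset.mul_sum, Finset.sum_mul, MonoidAlgebra.single_mul_single, mul_one]
    refine Finset.sum_bij' (fun x _ => g * x * g⁻¹) (fun x _ => g⁻¹ * x * g) ?_ ?_ ?_ ?_ ?_
    · intro x hx
      exact (key _).2 <| ((key _).1 hx).trans (isConj_iff.2 ⟨g, rfl⟩)
    · intro x hx
      exact (key _).2 <| ((key _).1 hx).trans (isConj_iff.2 ⟨g⁻¹, by simp⟩)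
    · intro x _; simp [mul_assoc]
    · intro x _; simp [mul_assoc]
    · intro x _; simp [mul_assoc]) i
  have hcint : IsIntegral ℤ c := by
    have : c = (MonoidAlgebra.mapRingHom G (Int.castRingHom ℂ))
        (∑ g ∈ (conjugatesOf z).toFinset, MonoidAlgebra.single g 1) := by
      simp [c, MonoidAlgebra.mapRingHom_single]
    rw [this]
    exact map_isIntegral_int _ (IsIntegral.of_finite ℤ _)
  have hωint : IsIntegral ℤ ω := by
    rw [← isIntegral_algebraMap_iff (A := ℂ) (B := Matrix (Fin (d i)) (Fin (d i)) ℂ)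
      (algebraMap ℂ _).injective, ← hω]
    exact map_isIntegral_int ((Pi.evalRingHom (fun i => Matrix (Fin (d i)) (Fin (d i)) ℂ) i).comp
      (e : MonoidAlgebra ℂ G →+* ∀ i, Matrix (Fin (d i)) (Fin (d i)) ℂ)) hcint
  have htr : (e c i).trace = Nat.card (conjugatesOf z) * (wedderburnRep e i z).trace := by
    have : ∀ g ∈ (conjugatesOf z).toFinset,
        (e (MonoidAlgebra.single g 1) i).trace = (wedderburnRep e i z).trace := by
      intro g hg
      obtain ⟨h, rfl⟩ := isConj_iff.1 ((key _).1 hg)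
      rw [← wedderburnRep_apply, map_mul, Matrix.trace_mul_comm, ← map_mul]
      simp
    simp only [c, map_sum, Finset.sum_apply, Matrix.trace_sum]
    rw [Finset.sum_congr rfl this]
    simp [Nat.card_eq_fintype_card]
  rw [hω] at htr
  have hd : (d i : ℂ) ≠ 0 := by exact_mod_cast NeZero.ne (d i)
  have : (Nat.card (conjugatesOf z) : ℂ) * (wedderburnRep e i z).trace / d i = ω := by
    rw [← htr, Matrix.algebraMap_eq_diagonal, Matrix.trace_diagonal]
    simp [hd]
  rwa [this]

theorem trace_eq_zero_or_scalar_of_coprime [Fintype G] (i : ι) [NeZero (d i)] {z : G}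
    (hco : (Nat.card (conjugatesOf z)).Coprime (d i)) :
    (wedderburnRep e i z).trace = 0 ∨ ∃ μ : ℂ, wedderburnRep e i z = algebraMap ℂ _ μ := by
  have hpow : wedderburnRep e i z ^ Fintype.card G = 1 := by
    rw [← map_pow, pow_card_eq_one, map_one]
  refine Matrix.trace_eq_zero_or_scalar Fintype.card_pos hpow ?_
  have h1 := isIntegral_card_mul_trace_div e i z
  have h2 := Matrix.isIntegral_trace_of_pow_eq_one Fintype.card_pos hpow
  have hd : (d i : ℂ) ≠ 0 := by exact_mod_cast NeZero.ne (d i)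
  obtain ⟨u, v, huv⟩ := Nat.isCoprime_iff_coprime.2 hco
  have huv' : (u : ℂ) * (Nat.card (conjugatesOf z) : ℂ) + v * d i = 1 := by exact_mod_cast huv
  have : (wedderburnRep e i z).trace / d i =
      u * ((Nat.card (conjugatesOf z) : ℂ) * (wedderburnRep e i z).trace / d i)
        + v * (wedderburnRep e i z).trace := by
    field_simp
    linear_combination -(wedderburnRep e i z).trace * huv'
  rw [this]
  exact ((isIntegral_intCast u).mul h1).add ((isIntegral_intCast v).mul h2)

theorem not_isIntegral_of_prime_mul_eq_neg_one {p : ℕ} (hp : p.Prime) {w : ℂ}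
    (hw : IsIntegral ℤ w) : (p : ℂ) * w ≠ -1 := by
  intro h
  have hp0 : (p : ℂ) ≠ 0 := by exact_mod_cast hp.ne_zero
  have hw' : w = algebraMap ℚ ℂ (-1 / p) := by
    simp only [eq_ratCast]
    push_cast
    field_simp
    rw [mul_comm, h]
  rw [hw', isIntegral_algebraMap_iff (algebraMap ℚ ℂ).injective,
    IsIntegrallyClosed.isIntegral_iff] at hw
  obtain ⟨n, hn⟩ := hw
  have hp1 : (p : ℚ) ≠ 0 := by exact_mod_cast hp.ne_zero
  rw [eq_div_iff hp1] at hn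
  have hn' : n * p = -1 := by
    rw [eq_intCast] at hn
    exact_mod_cast hn
  have : (p : ℤ) ∣ 1 := ⟨-n, by linarith⟩
  exact hp.one_lt.ne' (by exact_mod_cast Int.eq_one_of_dvd_one (by positivity) this)

theorem wedderburnRep_eq_one_apply {i : ι} (hi : wedderburnRep e i = 1) (x : MonoidAlgebra ℂ G) :
    e x i = algebraMap ℂ _ (MonoidAlgebra.lift ℂ ℂ G 1 x) := by
  induction x using MonoidAlgebra.induction_on with
  | of g => simpa [wedderburnRep_apply] using DFunLike.congr_fun hi g
  | add x y hx hy => simp [hx, hy]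
  | smul r x hx =>
    rw [map_smul, map_smul, Pi.smul_apply, hx, smul_eq_mul, map_mul, Algebra.smul_def]

theorem dim_eq_one_of_wedderburnRep_eq_one {i : ι} [NeZero (d i)] (hi : wedderburnRep e i = 1) :
    d i = 1 := by
  classical
  have hsurj : Function.Surjective (Algebra.linearMap ℂ (Matrix (Fin (d i)) (Fin (d i)) ℂ)) := by
    intro M
    refine ⟨MonoidAlgebra.lift ℂ ℂ G 1 (e.symm (Pi.single i M)), ?_⟩
    rw [Algebra.linearMap_apply, ← wedderburnRep_eq_one_apply e hi]
    simp
  have := LinearMap.finrank_le_finrank_of_surjective hsurj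
  rw [Module.finrank_matrix] at this
  simp only [Fintype.card_fin, Module.finrank_self, mul_one] at this
  have := NeZero.pos (d i)
  nlinarith

theorem eq_of_wedderburnRep_eq_one {i j : ι} [NeZero (d i)] [NeZero (d j)]
    (hi : wedderburnRep e i = 1) (hj : wedderburnRep e j = 1) : i = j := by
  classical
  by_contra hij
  have h1 := wedderburnRep_eq_one_apply e hi (e.symm (Pi.single i 1))
  have h2 := wedderburnRep_eq_one_apply e hj (e.symm (Pi.single i 1))
  simp only [AlgEquiv.apply_symm_apply, Pi.single_eq_same,
    Pi.single_eq_of_ne (Ne.symm hij)] at h1 h2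
  have h3 := (map_eq_zero_iff (algebraMap ℂ _) (algebraMap ℂ _).injective).1 h2.symm
  rw [h3, map_zero] at h1
  exact one_ne_zero h1

theorem exists_wedderburnRep_eq_one [Fintype G] : ∃ i, wedderburnRep e i = 1 := by
  classical
  let c : MonoidAlgebra ℂ G := ∑ g, MonoidAlgebra.single g 1
  have hl : ∀ g, MonoidAlgebra.single g 1 * c = c := fun g => by
    simp only [c, Finset.mul_sum, MonoidAlgebra.single_mul_single, mul_one]
    exact Fintype.sum_equiv (Equiv.mulLeft g) _ _ fun _ => rfl
  have hr : ∀ g, c * MonoidAlgebra.single g 1 = c := fun g => by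
    simp only [c, Finset.sum_mul, MonoidAlgebra.single_mul_single, mul_one]
    exact Fintype.sum_equiv (Equiv.mulRight g) _ _ fun _ => rfl
  have hc0 : c ≠ 0 := by
    intro h
    have := congrArg (MonoidAlgebra.lift ℂ ℂ G 1) h
    simp [c] at this
  have hec : e c ≠ 0 := fun h => hc0 ((map_eq_zero_iff e e.injective).1 h)
  obtain ⟨i, hi⟩ := Function.ne_iff.1 hec
  refine ⟨i, MonoidHom.ext fun g => ?_⟩
  obtain ⟨ω, hω⟩ := exists_scalar_of_central e (fun g => (hl g).trans (hr g).symm) i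
  have hω0 : ω ≠ 0 := by
    rintro rfl
    exact hi (by rw [hω]; simp)
  have hg := congrArg (fun x => e x i) (hl g)
  simp only [map_mul, Pi.mul_apply, hω] at hg
  rw [← wedderburnRep_apply, ← Algebra.commutes, ← Algebra.smul_def,
    Algebra.algebraMap_eq_smul_one] at hg
  exact smul_right_injective _ hω0 hg

end Wedderburn

/-- A finite group with a nontrivial element whose conjugacy class has prime power order is
commutative or not simple. -/
theorem exists_normal_of_card_conjugatesOf_eq_prime_pow {G : Type*} [Group G] [Finite G]
    {p k : ℕ} (hp : p.Prime) {z : G} (hz : z ≠ 1) (hcard : Nat.card (conjugatesOf z) = p ^ k) :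
    (∀ a b : G, a * b = b * a) ∨ ∃ N : Subgroup G, N.Normal ∧ N ≠ ⊥ ∧ N ≠ ⊤ := by
  classical
  have := Fintype.ofFinite G
  by_contra! hcon
  obtain ⟨⟨a, b, hab⟩, hN⟩ := hcon
  obtain ⟨n, d, hd, ⟨e⟩⟩ :=
    IsSemisimpleRing.exists_algEquiv_pi_matrix_of_isAlgClosed ℂ (MonoidAlgebra ℂ G)
  have hcases : ∀ i, wedderburnRep e i = 1 ∨
      ∃ w : ℂ, IsIntegral ℤ w ∧ (d i : ℂ) * (wedderburnRep e i z).trace = p * w := by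
    intro i
    by_cases hdvd : p ∣ d i
    · obtain ⟨m, hm⟩ := hdvd
      refine Or.inr ⟨m * (wedderburnRep e i z).trace, ?_, ?_⟩
      swap
      · have hm' : (d i : ℂ) = p * m := by exact_mod_cast hm
        rw [hm', mul_assoc]
      refine (isIntegral_natCast m).mul (Matrix.isIntegral_trace_of_pow_eq_one
        (m := Fintype.card G) Fintype.card_pos ?_)
      rw [← map_pow, pow_card_eq_one, map_one]
    rcases trace_eq_zero_or_scalar_of_coprime e i (z := z)
      (by rw [hcard]; exact ((Nat.Prime.coprime_iff_not_dvd hp).2 hdvd).pow_left k) with h | ⟨μ, h⟩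
    · exact Or.inr ⟨0, isIntegral_zero, by rw [h]; simp⟩
    left
    let ρ := (wedderburnRep e i).toHomUnits
    have hcomm : (Subgroup.center _).comap ρ = ⊤ := by
      refine hN _ inferInstance fun hbot => hz ?_
      rw [← Subgroup.mem_bot, ← hbot, Subgroup.mem_comap, Subgroup.mem_center_iff]
      intro u
      ext1
      simp only [ρ, Units.val_mul, MonoidHom.coe_toHomUnits, h]
      exact (Algebra.commutes _ _).symm
    have hker : ρ.ker = ⊤ := by
      refine hN _ inferInstance fun hbot => hab ?_
      refine (MonoidHom.ker_eq_bot_iff ρ).1 hbot ?_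
      have hb : b ∈ (Subgroup.center _).comap ρ := hcomm ▸ Subgroup.mem_top b
      rw [map_mul, map_mul, Subgroup.mem_center_iff.1 hb]
    refine MonoidHom.ext fun g => ?_
    have hg : g ∈ ρ.ker := hker ▸ Subgroup.mem_top g
    simpa [ρ] using congrArg Units.val (MonoidHom.mem_ker.1 hg)
  obtain ⟨i₀, hi₀⟩ := exists_wedderburnRep_eq_one e
  have hcases' : ∀ i, i ≠ i₀ →
      ∃ w : ℂ, IsIntegral ℤ w ∧ (d i : ℂ) * (wedderburnRep e i z).trace = p * w := fun i hi =>
    (hcases i).resolve_left fun h => hi (eq_of_wedderburnRep_eq_one e h hi₀)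
  choose! w hwint hw using hcases'
  have hsum := sum_mul_trace_wedderburnRep e hz
  rw [← Finset.add_sum_erase _ _ (Finset.mem_univ i₀), hi₀,
    Finset.sum_congr rfl fun i hi => hw i (Finset.ne_of_mem_erase hi), ← Finset.mul_sum,
    MonoidHom.one_apply, Matrix.trace_one, Fintype.card_fin,
    dim_eq_one_of_wedderburnRep_eq_one e hi₀] at hsum
  refine not_isIntegral_of_prime_mul_eq_neg_one hp
    (IsIntegral.sum (s := Finset.univ.erase i₀) w fun i hi => hwint i (Finset.ne_of_mem_erase hi)) ?_
  linear_combination hsum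

section Solvability

open MulAction

theorem Nat.card_conjugatesOf_eq_index_centralizer {G : Type*} [Group G] (z : G) :
    Nat.card (conjugatesOf z) = (Subgroup.centralizer {z}).index := by
  have h1 : conjugatesOf z = orbit (ConjAct G) z := by
    ext x
    rw [ConjAct.mem_orbit_conjAct]
    exact isConj_comm
  rw [h1, Nat.card_coe_set_eq, ← index_stabilizer, ConjAct.stabilizer_eq_centralizer]
  rfl

theorem isSolvable_of_normal {G : Type*} [Group G] (N : Subgroup G) [N.Normal]
    (h1 : Group.IsSolvable N) (h2 : Group.IsSolvable (G ⧸ N)) : Group.IsSolvable G :=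
  (Group.isSolvable_iff_subgroup_quotient N).2 ⟨h1, h2⟩

/-- **Burnside's theorem**: a finite group whose order has at most two prime divisors is solvable. -/
theorem isSolvable_of_prime_dvd_card_eq_or_eq {p q : ℕ} (hp : p.Prime) (hq : q.Prime)
    (G : Type*) [Group G] [Finite G]
    (hG : ∀ r : ℕ, r.Prime → r ∣ Nat.card G → r = p ∨ r = q) : Group.IsSolvable G := by
  induction hn : Nat.card G using Nat.strong_induction_on generalizing G with
  | _ n ih =>
  have hfp : Fact p.Prime := ⟨hp⟩
  have hfq : Fact q.Prime := ⟨hq⟩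
  by_cases hqG : q ∣ Nat.card G
  swap
  · have hpG : IsPGroup p G := IsPGroup.of_card
      (Nat.eq_prime_pow_of_unique_prime_dvd Nat.card_pos.ne' fun {r} hr hrG =>
        (hG r hr hrG).resolve_right fun h => hqG (h ▸ hrG))
    have := hpG.isNilpotent
    infer_instance
  obtain ⟨Q⟩ : Nonempty (Sylow q G) := inferInstance
  have hQ : Nontrivial Q := by
    rw [← Finite.one_lt_card_iff_nontrivial, Q.card_eq_multiplicity]
    exact Nat.one_lt_pow (hq.factorization_pos_of_dvd Nat.card_pos.ne' hqG).ne' hq.one_lt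
  obtain ⟨⟨z, hzc⟩, hz⟩ := @exists_ne _ Q.2.center_nontrivial 1
  have hz1 : (z : G) ≠ 1 := fun h => hz (Subtype.ext (Subtype.ext h))
  have hQz : (Q : Subgroup G) ≤ Subgroup.centralizer {(z : G)} := by
    intro x hx
    rw [Subgroup.mem_centralizer_singleton_iff]
    exact congrArg Subtype.val (Subgroup.mem_center_iff.1 hzc ⟨x, hx⟩)
  have hcard : Nat.card (conjugatesOf (z : G)) =
      p ^ (Nat.card (conjugatesOf (z : G))).primeFactorsList.length := by
    rw [Nat.card_conjugatesOf_eq_index_centralizer]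
    refine Nat.eq_prime_pow_of_unique_prime_dvd Subgroup.index_ne_zero_of_finite fun {r} hr hrd =>
      (hG r hr (hrd.trans (Subgroup.index_dvd_card _))).resolve_right ?_
    rintro rfl
    exact Q.not_dvd_index (hrd.trans (Subgroup.index_dvd_of_le hQz))
  rcases exists_normal_of_card_conjugatesOf_eq_prime_pow hp hz1 hcard with h | ⟨N, hN, hbot, htop⟩
  · exact Group.isSolvable_of_comm h
  refine isSolvable_of_normal N (ih _ ?_ _ (fun r hr hrN => hG r hr
    (hrN.trans N.card_subgroup_dvd_card)) rfl) (ih _ ?_ _ (fun r hr hrN => hG r hr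
    (hrN.trans N.card_quotient_dvd_card)) rfl)
  · rw [← hn]
    exact lt_of_le_of_ne (Nat.card_le_card_of_injective _ N.subtype_injective)
      fun h => htop (N.eq_top_of_card_eq h)
  · rw [← hn, ← N.card_mul_index]
    exact lt_mul_left Subgroup.index_ne_zero_of_finite.bot_lt (N.one_lt_card_iff_ne_bot.2 hbot)

section Coprime

variable {G : Type*} [Group G] [Finite G]

theorem Subgroup.relIndex_eq_index_of_coprime {H K : Subgroup G}
    (h : H.index.Coprime K.index) : K.relIndex H = K.index := by
  have h1 : K.index ∣ (K ⊓ H).index := Subgroup.index_dvd_of_le inf_le_left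
  rw [← Subgroup.relIndex_mul_index (inf_le_right : K ⊓ H ≤ H), Subgroup.inf_relIndex_right] at h1
  refine le_antisymm ?_ (Nat.le_of_dvd (Nat.pos_of_ne_zero ?_)
    (h.symm.dvd_of_dvd_mul_right h1))
  · rw [← K.relIndex_top_right]
    exact Subgroup.relIndex_le_of_le_right le_top (by
      rw [K.relIndex_top_right]; exact Subgroup.index_ne_zero_of_finite)
  · exact Subgroup.index_ne_zero_of_finite

theorem Subgroup.isPretransitive_quotient_of_coprime {H K : Subgroup G}
    (h : H.index.Coprime K.index) : IsPretransitive H (G ⧸ K) := by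
  rw [isPretransitive_iff_orbit_eq_univ ((1 : G) : G ⧸ K)]
  refine Set.eq_of_subset_of_ncard_le (Set.subset_univ _) ?_ (Set.toFinite _)
  have hst : stabilizer H ((1 : G) : G ⧸ K) = K.subgroupOf H := by
    ext x
    rw [mem_stabilizer_iff, Subgroup.mem_subgroupOf]
    change ((x * 1 : G) : G ⧸ K) = ((1 : G) : G ⧸ K) ↔ _
    rw [mul_one, eq_comm, QuotientGroup.eq, inv_one, one_mul]
  rw [← index_stabilizer, hst, Set.ncard_univ, ← Subgroup.index_eq_card,
    ← Subgroup.relIndex_eq_index_of_coprime h]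
  rfl

/-- A `p`-subgroup normalised by `H` is contained in every conjugate of `K`, provided `H` and `K`
have coprime indices and `p` does not divide the index of `K`. -/
theorem IsPGroup.le_normalCore_of_coprime {p : ℕ} [Fact p.Prime] {N H K : Subgroup G}
    (hN : IsPGroup p N) (hNH : H ≤ Subgroup.normalizer (N : Set G)) (h : H.index.Coprime K.index)
    (hp : ¬ p ∣ K.index) : N ≤ K.normalCore := by
  have := Subgroup.isPretransitive_quotient_of_coprime h
  obtain ⟨x, hx⟩ := hN.nonempty_fixed_point_of_prime_not_dvd_card (G ⧸ K)
    (by rwa [← Subgroup.index_eq_card])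
  intro n hn b
  obtain ⟨k, hk⟩ := exists_smul_eq H x ((b⁻¹ : G) : G ⧸ K)
  have hmem : (k : G)⁻¹ * n * k ∈ N := by
    have := (Subgroup.mem_normalizer_iff.1 (inv_mem (hNH k.2)) n).1 hn
    simpa using this
  have h1 : ((k : G)⁻¹ * n * k) • x = x := hx ⟨_, hmem⟩
  have h2 : n • ((b⁻¹ : G) : G ⧸ K) = ((b⁻¹ : G) : G ⧸ K) := by
    have hk' : (k : G) • x = ((b⁻¹ : G) : G ⧸ K) := hk
    rw [← hk']
    conv_rhs => rw [← h1]
    simp only [← mul_smul]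
    congr 1
    group
  rw [Quotient.smul_coe, smul_eq_mul, eq_comm, QuotientGroup.eq] at h2
  simpa [mul_assoc] using h2

theorem exists_normal_isPGroup_of_isSolvable [Nontrivial G] [Group.IsSolvable G] :
    ∃ p : ℕ, p.Prime ∧ ∃ N : Subgroup G, N.Normal ∧ IsPGroup p N ∧ N ≠ ⊥ := by
  classical
  have hex := Group.IsSolvable.solvable (G := G)
  obtain ⟨n, hn⟩ : ∃ n, Nat.find hex = n + 1 := by
    refine Nat.exists_eq_succ_of_ne_zero fun h0 => ?_
    have := Nat.find_spec hex
    rw [h0, derivedSeries_zero] at this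
    exact top_ne_bot this
  have hA : derivedSeries G n ≠ ⊥ := Nat.find_min hex (by omega)
  have hA' : derivedSeries G (n + 1) = ⊥ := hn ▸ Nat.find_spec hex
  have hcomm : ∀ a ∈ derivedSeries G n, ∀ b ∈ derivedSeries G n, a * b = b * a := by
    intro a ha b hb
    rw [derivedSeries_succ, Subgroup.commutator_eq_bot_iff_le_centralizer] at hA'
    exact (Subgroup.mem_centralizer_iff.1 (hA' ha) b hb).symm
  obtain ⟨p, hp, hpd⟩ := Nat.exists_prime_and_dvd ((Subgroup.one_lt_card_iff_ne_bot _).2 hA).ne'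
  have : Fact p.Prime := ⟨hp⟩
  let N : Subgroup G :=
    { carrier := {a | a ∈ derivedSeries G n ∧ a ^ p = 1}
      one_mem' := ⟨one_mem _, one_pow p⟩
      mul_mem' := fun {a b} ha hb => ⟨mul_mem ha.1 hb.1, by
        rw [(show Commute a b from hcomm a ha.1 b hb.1).mul_pow, ha.2, hb.2, one_mul]⟩
      inv_mem' := fun {a} ha => ⟨inv_mem ha.1, by rw [inv_pow, ha.2, inv_one]⟩ }
  refine ⟨p, hp, N, ⟨fun a ha g => ⟨(derivedSeries_normal G n).conj_mem a ha.1 g, ?_⟩⟩, ?_, ?_⟩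
  · rw [conj_pow, ha.2, mul_one, mul_inv_cancel]
  · exact fun a => ⟨1, Subtype.ext (by simpa using a.2.2)⟩
  · obtain ⟨a, ha⟩ := exists_prime_orderOf_dvd_card' p hpd
    intro hbot
    have haN : (a : G) ∈ N := ⟨a.2, by rw [← Subgroup.coe_pow, ← ha, pow_orderOf_eq_one]; rfl⟩
    rw [hbot, Subgroup.mem_bot] at haN
    rw [show a = 1 from Subtype.ext haN, orderOf_one] at ha
    exact hp.one_lt.ne ha

end Coprime

/-- **Wielandt's theorem**: a finite group with three solvable subgroups of pairwise coprime
indices is solvable. -/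
theorem isSolvable_of_coprime_index (G : Type*) [Group G] [Finite G] (H₁ H₂ H₃ : Subgroup G)
    (h₁ : Group.IsSolvable H₁) (h₂ : Group.IsSolvable H₂) (h₃ : Group.IsSolvable H₃)
    (h₁₂ : H₁.index.Coprime H₂.index) (h₁₃ : H₁.index.Coprime H₃.index)
    (h₂₃ : H₂.index.Coprime H₃.index) : Group.IsSolvable G := by
  induction hn : Nat.card G using Nat.strong_induction_on generalizing G with
  | _ n ih =>
  rcases eq_or_ne H₁ ⊥ with rfl | hbot
  · have htop : H₂ = ⊤ := Subgroup.index_eq_one.1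
      (Nat.eq_one_of_dvd_coprimes h₁₂ (by rw [Subgroup.index_bot]; exact H₂.index_dvd_card)
        dvd_rfl)
    subst htop
    exact Group.isSolvable_of_surjective (f := (⊤ : Subgroup G).subtype) fun g => ⟨⟨g, trivial⟩, rfl⟩
  have : Nontrivial H₁ := (Subgroup.nontrivial_iff_ne_bot _).2 hbot
  obtain ⟨p, hp, N, hNn, hNp, hN⟩ := exists_normal_isPGroup_of_isSolvable (G := H₁)
  have : Fact p.Prime := ⟨hp⟩
  have hN' : IsPGroup p (N.map H₁.subtype) := hNp.map _
  have hNH : H₁ ≤ Subgroup.normalizer (N.map H₁.subtype : Set G) := by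
    have := Subgroup.le_normalizer_map (H := N) H₁.subtype
    rwa [Subgroup.normalizer_eq_top, ← MonoidHom.range_eq_map, Subgroup.range_subtype] at this
  have hNbot : N.map H₁.subtype ≠ ⊥ := by
    rwa [Ne, Subgroup.map_eq_bot_iff_of_injective _ H₁.subtype_injective]
  obtain ⟨C, hCn, hCbot, hC⟩ : ∃ C : Subgroup G, C.Normal ∧ C ≠ ⊥ ∧ Group.IsSolvable C := by
    by_cases hp2 : p ∣ H₂.index
    · have hp3 : ¬ p ∣ H₃.index := fun hp3 =>
        hp.one_lt.ne' (Nat.eq_one_of_dvd_coprimes h₂₃ hp2 hp3)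
      refine ⟨H₃.normalCore, inferInstance, fun h => hNbot ?_, ?_⟩
      · exact le_bot_iff.1 (h ▸ hN'.le_normalCore_of_coprime hNH h₁₃ hp3)
      · exact Group.isSolvable_of_isSolvable_injective
          (Subgroup.inclusion_injective H₃.normalCore_le)
    · refine ⟨H₂.normalCore, inferInstance, fun h => hNbot ?_, ?_⟩
      · exact le_bot_iff.1 (h ▸ hN'.le_normalCore_of_coprime hNH h₁₂ hp2)
      · exact Group.isSolvable_of_isSolvable_injective
          (Subgroup.inclusion_injective H₂.normalCore_le)
  have hsurj := QuotientGroup.mk'_surjective C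
  have himg : ∀ H : Subgroup G, Group.IsSolvable H →
      Group.IsSolvable (H.map (QuotientGroup.mk' C)) := fun H hH =>
    Group.isSolvable_of_surjective ((QuotientGroup.mk' C).subgroupMap_surjective H)
  have hcop : ∀ {H K : Subgroup G}, H.index.Coprime K.index →
      (H.map (QuotientGroup.mk' C)).index.Coprime (K.map (QuotientGroup.mk' C)).index :=
    fun h => h.of_dvd (Subgroup.index_map_dvd _ hsurj) (Subgroup.index_map_dvd _ hsurj)
  refine isSolvable_of_normal C hC (ih _ ?_ (G ⧸ C) _ _ _ (himg H₁ h₁) (himg H₂ h₂) (himg H₃ h₃)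
    (hcop h₁₂) (hcop h₁₃) (hcop h₂₃) rfl)
  rw [← hn, ← C.card_mul_index]
  exact lt_mul_left Subgroup.index_ne_zero_of_finite.bot_lt (C.one_lt_card_iff_ne_bot.2 hCbot)

/-- **Hall's theorem**: a finite group with a `p`-complement for every prime `p` is solvable. -/
theorem isSolvable_of_forall_exists_complement (G : Type*) [Group G] [Finite G]
    (hG : ∀ p : ℕ, p.Prime → ∃ H : Subgroup G, (∃ k, H.index = p ^ k) ∧ ¬ p ∣ Nat.card H) :
    Group.IsSolvable G := by
  induction hn : Nat.card G using Nat.strong_induction_on generalizing G with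
  | _ n ih =>
  by_cases htwo : ∃ p q : ℕ, p.Prime ∧ q.Prime ∧
      ∀ r : ℕ, r.Prime → r ∣ Nat.card G → r = p ∨ r = q
  · obtain ⟨p, q, hp, hq, h⟩ := htwo
    exact isSolvable_of_prime_dvd_card_eq_or_eq hp hq G h
  push Not at htwo
  obtain ⟨p₁, hp₁, hd₁, -⟩ := htwo 2 2 Nat.prime_two Nat.prime_two
  obtain ⟨p₂, hp₂, hd₂, h₂₁, -⟩ := htwo p₁ p₁ hp₁ hp₁
  obtain ⟨p₃, hp₃, hd₃, h₃₁, h₃₂⟩ := htwo p₁ p₂ hp₁ hp₂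
  choose! H hidx hcard using hG
  choose! k hk using hidx
  have hcop : ∀ {p q : ℕ}, p.Prime → q.Prime → p ≠ q → (H p).index.Coprime (H q).index := by
    intro p q hp hq hpq
    rw [hk p hp, hk q hq]
    exact Nat.Coprime.pow _ _ ((Nat.coprime_primes hp hq).2 hpq)
  have hsol : ∀ p : ℕ, p.Prime → p ∣ Nat.card G → Group.IsSolvable (H p) := by
    intro p hp hpG
    refine ih _ ?_ (H p) (fun q hq => ?_) rfl
    · rw [← hn]
      refine lt_of_le_of_ne (Nat.card_le_card_of_injective _ (H p).subtype_injective) fun h => ?_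
      exact hcard p hp (h ▸ hpG)
    · rcases eq_or_ne p q with rfl | hpq
      · exact ⟨⊤, ⟨0, by simp⟩, by simpa using hcard p hp⟩
      · refine ⟨(H q).subgroupOf (H p), ⟨k q, ?_⟩, fun hdvd => hcard q hq (hdvd.trans ?_)⟩
        · rw [← hk q hq, ← Subgroup.relIndex_eq_index_of_coprime (hcop hp hq hpq)]
          rfl
        · exact Subgroup.card_comap_dvd_of_injective _ _ (H p).subtype_injective
  exact isSolvable_of_coprime_index G (H p₁) (H p₂) (H p₃) (hsol _ hp₁ hd₁) (hsol _ hp₂ hd₂)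
    (hsol _ hp₃ hd₃) (hcop hp₁ hp₂ h₂₁.symm) (hcop hp₁ hp₃ h₃₁.symm) (hcop hp₂ hp₃ h₃₂.symm)

end Solvability

/-- A finite group admitting a bijective cocycle into a finite abelian group is solvable. -/
theorem isSolvable_of_bijective_cocycle {Γ A : Type*} [Group Γ] [Finite Γ] [CommGroup A]
    [Finite A] (act : Γ →* MulAut A) (π : Γ → A) (hπ : Function.Bijective π)
    (hmul : ∀ g h, π (g * h) = π g * act g (π h)) : Group.IsSolvable Γ := by
  refine isSolvable_of_forall_exists_complement Γ fun p hp => ?_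
  have : Fact p.Prime := ⟨hp⟩
  obtain ⟨k, M, hM, hA⟩ := Nat.exists_eq_pow_mul_and_not_dvd (Nat.card_pos (α := A)).ne' p
    hp.ne_one
  have hone : π 1 = 1 := by simpa using hmul 1 1
  let S : Subgroup A := (powMonoidHom M).ker
  have hS : ∀ {a : A}, a ∈ S ↔ a ^ M = 1 := Iff.rfl
  have hact : ∀ (g : Γ) {a : A}, a ∈ S → act g a ∈ S := by
    intro g a ha
    rw [hS] at ha ⊢
    rw [← map_pow, ha, map_one]
  let H : Subgroup Γ :=
    { carrier := {g | π g ∈ S}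
      one_mem' := by simp [hone]
      mul_mem' := fun {g h} (hg : π g ∈ S) (hh : π h ∈ S) => show π (g * h) ∈ S by
        rw [hmul]
        exact mul_mem hg (hact g hh)
      inv_mem' := fun {g} (hg : π g ∈ S) => show π g⁻¹ ∈ S by
        have h := hmul g⁻¹ g
        rw [inv_mul_cancel, hone] at h
        rw [eq_inv_of_mul_eq_one_left h.symm]
        exact inv_mem (hact _ hg) }
  have hHS : Nat.card H = Nat.card S :=
    Nat.card_congr ((Equiv.ofBijective π hπ).subtypeEquiv fun _ => Iff.rfl)
  have hidx : H.index = S.index := by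
    refine Nat.eq_of_mul_eq_mul_left (Nat.card_pos (α := S)) ?_
    rw [S.card_mul_index, ← hHS, H.card_mul_index]
    exact Nat.card_congr (Equiv.ofBijective π hπ)
  refine ⟨H, ⟨_, Nat.eq_prime_pow_of_unique_prime_dvd Subgroup.index_ne_zero_of_finite ?_⟩, ?_⟩
  · intro q hq hqd
    have : Fact q.Prime := ⟨hq⟩
    rw [hidx, Subgroup.index_eq_card] at hqd
    obtain ⟨a, ha⟩ := exists_prime_orderOf_dvd_card' q hqd
    induction a using QuotientGroup.induction_on with | H a => ?_
    have hpa : (a : A ⧸ S) ^ (p ^ k) = 1 := by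
      rw [← QuotientGroup.mk_pow, QuotientGroup.eq_one_iff, hS, ← pow_mul, ← hA]
      exact pow_card_eq_one'
    rw [← orderOf_dvd_iff_pow_eq_one, ha] at hpa
    exact (Nat.prime_dvd_prime_iff_eq hq hp).1 (hq.dvd_of_dvd_pow hpa)
  · rw [hHS]
    intro hpd
    obtain ⟨a, ha⟩ := exists_prime_orderOf_dvd_card' p hpd
    exact hM (ha ▸ orderOf_dvd_of_pow_eq_one (Subtype.ext (hS.1 a.2)))

/-- If `f` has finite order then the operator `v ↦ f v / v` does not turn a non-fixed vector into a
fixed one. -/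
theorem MulAut.map_div_ne_of_map_ne {A : Type*} [CommGroup A] [IsMulTorsionFree A] {f : MulAut A}
    (hf : IsOfFinOrder f) {v : A} (hv : f v ≠ v) : f (f v / v) ≠ f v / v := by
  intro hw
  obtain ⟨n, hn, hfn⟩ := isOfFinOrder_iff_pow_eq_one.1 hf
  have hpow : ∀ k : ℕ, (f ^ k) v = v * (f v / v) ^ k := by
    intro k
    induction k with
    | zero => simp
    | succ k ih =>
      rw [pow_succ', MulAut.mul_apply, ih, map_mul, map_pow, hw, pow_succ', ← mul_assoc,
        mul_div_cancel]
  have h1 := hpow n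
  rw [hfn, MulAut.one_apply, left_eq_mul, pow_eq_one_iff_left hn.ne'] at h1
  exact hv (div_eq_one.1 h1)

/-- The derived length of an extension with abelian kernel exceeds that of the quotient by at most
one. -/
theorem derivedSeries_succ_eq_bot_of_ker_comm {G H : Type*} [Group G] [Group H] (f : G →* H)
    (hker : ∀ a ∈ f.ker, ∀ b ∈ f.ker, a * b = b * a) {n : ℕ} (hn : derivedSeries H n = ⊥) :
    derivedSeries G (n + 1) = ⊥ := by
  have hle : derivedSeries G n ≤ f.ker := by
    rw [← MonoidHom.comap_bot, ← Subgroup.map_le_iff_le_comap, ← hn]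
    exact map_derivedSeries_le_derivedSeries f n
  rw [derivedSeries_succ, Subgroup.commutator_eq_bot_iff_le_centralizer]
  exact fun a ha => Subgroup.mem_centralizer_iff.2 fun b hb => hker b (hle hb) a (hle ha)

namespace YBPaper

variable {X : Type*}

theorem solLength_eq_succ (G : Type*) [Group G] (n : ℕ) (h1 : derivedSeries G (n + 1) = ⊥)
    (h2 : derivedSeries G n ≠ ⊥) : solLength G = n + 1 := by
  refine le_antisymm (Nat.sInf_le h1) (Nat.succ_le_of_lt (lt_of_not_ge fun hle => h2 ?_))
  have hmem : derivedSeries G (solLength G) = ⊥ := Nat.sInf_mem (s := {n | derivedSeries G n = ⊥})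
    ⟨n + 1, h1⟩
  exact le_bot_iff.1 (hmem ▸ derivedSeries_antitone G hle)

namespace IsSquareFreeSolution

variable {r : X × X → X × X} (h : IsSquareFreeSolution r)

/-- The left translation by `x` as a permutation. -/
noncomputable def lperm (x : X) : Equiv.Perm X := Equiv.ofBijective _ (h.nondegL x)

theorem lperm_apply (x y : X) : h.lperm x y = (r (x, y)).1 := rfl

theorem lperm_self (x : X) : h.lperm x x = x := by rw [lperm_apply, h.sqfree]

theorem lperm_lperm (x y : X) : h.lperm (r (x, y)).1 (r (x, y)).2 = x := by
  rw [lperm_apply, Prod.mk.eta, h.invol]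

theorem lperm_mul_lperm (x y : X) :
    h.lperm x * h.lperm y = h.lperm (r (x, y)).1 * h.lperm (r (x, y)).2 := by
  ext z
  exact (congrArg Prod.fst (h.braided (x, y, z))).symm

theorem of_mul_of (x y : X) : (PresentedGroup.of x * PresentedGroup.of y :
    PresentedGroup (structRels r)) =
      PresentedGroup.of (r (x, y)).1 * PresentedGroup.of (r (x, y)).2 :=
  mul_inv_eq_one.1 (PresentedGroup.one_of_mem ⟨x, y, rfl⟩)

theorem of_mul_of_lperm_symm (x y : X) :
    (PresentedGroup.of x * PresentedGroup.of ((h.lperm x)⁻¹ y) : PresentedGroup (structRels r)) =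
      PresentedGroup.of y * PresentedGroup.of ((h.lperm y)⁻¹ x) := by
  have h1 : (r (x, (h.lperm x)⁻¹ y)).1 = y := (h.lperm x).apply_symm_apply y
  have h2 : (h.lperm y)⁻¹ x = (r (x, (h.lperm x)⁻¹ y)).2 := by
    rw [Equiv.Perm.inv_eq_iff_eq]
    have h3 := h.lperm_lperm x ((h.lperm x)⁻¹ y)
    rw [h1] at h3
    exact h3.symm
  rw [of_mul_of, h1, h2]

open Classical in
/-- The standard basis vectors of `ℤ^X`, written multiplicatively. -/
noncomputable def basisVec (x : X) : X → Multiplicative ℤ :=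
  Pi.mulSingle x (Multiplicative.ofAdd 1)

theorem mulAutArrow_basisVec (σ : Equiv.Perm X) (x : X) :
    mulAutArrow σ (basisVec x) = basisVec (σ x) := by
  classical
  exact Pi.mulSingle_comp_equiv σ⁻¹ x _

theorem closure_range_basisVec [Finite X] :
    Subgroup.closure (Set.range (basisVec : X → X → Multiplicative ℤ)) = ⊤ := by
  classical
  have := Fintype.ofFinite X
  refine eq_top_iff.2 fun v _ => ?_
  rw [← Finset.univ_prod_mulSingle v]
  refine prod_mem fun x _ => ?_
  have hx : Pi.mulSingle x (v x) = basisVec x ^ (v x).toAdd := by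
    rw [basisVec, ← Pi.mulSingle_zpow, ← ofAdd_zsmul, smul_eq_mul, mul_one, ofAdd_toAdd]
  rw [hx]
  exact zpow_mem (Subgroup.subset_closure (Set.mem_range_self x)) _

/-- The homomorphism `x ↦ (e_x, L_x)` from the structure group to `ℤ^X ⋊ Sym(X)`. -/
noncomputable def toAffine :
    PresentedGroup (structRels r) →* (X → Multiplicative ℤ) ⋊[mulAutArrow] Equiv.Perm X :=
  PresentedGroup.toGroup (f := fun x => SemidirectProduct.mk (basisVec x) (h.lperm x)) (by
    rintro _ ⟨x, y, rfl⟩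
    simp only [map_mul, map_inv, FreeGroup.lift_apply_of, mul_inv_eq_one]
    ext1
    · simp only [SemidirectProduct.mul_left, mulAutArrow_basisVec]
      rw [h.lperm_lperm, h.lperm_apply, mul_comm]
    · exact h.lperm_mul_lperm x y)

/-- The action of the structure group on `X`. -/
noncomputable def toPerm : PresentedGroup (structRels r) →* Equiv.Perm X :=
  SemidirectProduct.rightHom.comp h.toAffine

theorem toAffine_of (x : X) : h.toAffine (PresentedGroup.of x) = ⟨basisVec x, h.lperm x⟩ :=
  PresentedGroup.toGroup.of _

theorem toPerm_of (x : X) : h.toPerm (PresentedGroup.of x) = h.lperm x := by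
  simp [toPerm, toAffine_of]

theorem range_toPerm : h.toPerm.range = Gcal r := by
  rw [MonoidHom.range_eq_map, ← PresentedGroup.closure_range_of, MonoidHom.map_closure, Gcal]
  congr 1
  ext σ
  constructor
  · rintro ⟨_, ⟨x, rfl⟩, rfl⟩
    exact ⟨x, fun y => by rw [toPerm_of]; rfl⟩
  · rintro ⟨x, hx⟩
    exact ⟨_, ⟨x, rfl⟩, by rw [toPerm_of]; ext y; exact (hx y).symm⟩

theorem toAffine_mul_of_left (g : PresentedGroup (structRels r)) (x : X) :
    (h.toAffine (g * PresentedGroup.of x)).left =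
      (h.toAffine g).left * basisVec (h.toPerm g x) := by
  rw [map_mul, SemidirectProduct.mul_left, toAffine_of, mulAutArrow_basisVec]
  rfl

/-- The permutation of the structure group which corresponds to translation by the basis vector
`basisVec y` of the lattice. -/
noncomputable def shift (y : X) : Equiv.Perm (PresentedGroup (structRels r)) where
  toFun g := g * PresentedGroup.of ((h.toPerm g)⁻¹ y)
  invFun g := g * (PresentedGroup.of ((h.toPerm g)⁻¹ y))⁻¹
  left_inv g := by
    have : (h.lperm ((h.toPerm g)⁻¹ y))⁻¹ ((h.toPerm g)⁻¹ y) = (h.toPerm g)⁻¹ y := by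
      rw [Equiv.Perm.inv_eq_iff_eq, lperm_self]
    beta_reduce
    rw [map_mul, toPerm_of, mul_inv_rev, Equiv.Perm.mul_apply, this, mul_inv_cancel_right]
  right_inv g := by simp [toPerm_of, lperm_self]

theorem shift_apply (y : X) (g : PresentedGroup (structRels r)) :
    h.shift y g = g * PresentedGroup.of ((h.toPerm g)⁻¹ y) := rfl

theorem shift_toPerm_apply (g : PresentedGroup (structRels r)) (x : X) :
    h.shift (h.toPerm g x) g = g * PresentedGroup.of x := by
  rw [shift_apply, Equiv.Perm.inv_def, Equiv.symm_apply_apply]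

theorem toAffine_shift_left (y : X) (g : PresentedGroup (structRels r)) :
    (h.toAffine (h.shift y g)).left = basisVec y * (h.toAffine g).left := by
  rw [shift_apply, toAffine_mul_of_left, Equiv.Perm.inv_def, Equiv.apply_symm_apply, mul_comm]

theorem commute_shift (x y : X) : Commute (h.shift x) (h.shift y) := by
  ext g
  simp only [Equiv.Perm.mul_apply, shift_apply, map_mul, toPerm_of, mul_inv_rev]
  rw [mul_assoc, mul_assoc, of_mul_of_lperm_symm]

theorem exists_shiftHom [Finite X] :
    ∃ F : (X → Multiplicative ℤ) →* Equiv.Perm (PresentedGroup (structRels r)),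
      ∀ y, F (basisVec y) = h.shift y := by
  classical
  have := Fintype.ofFinite X
  refine ⟨MonoidHom.noncommPiCoprod (fun y => zpowersHom _ (h.shift y)) fun x y _ m n => ?_,
    fun y => ?_⟩
  · exact (h.commute_shift x y).zpow_zpow _ _
  · exact (MonoidHom.noncommPiCoprod_mulSingle _ y _).trans (by simp)

theorem bijective_toAffine_left [Finite X] :
    Function.Bijective fun g => (h.toAffine g).left := by
  obtain ⟨F, hF⟩ := h.exists_shiftHom
  have hleft : ∀ v g, (h.toAffine (F v g)).left = v * (h.toAffine g).left := by
    intro v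
    have hv : v ∈ Subgroup.closure (Set.range basisVec) :=
      closure_range_basisVec (X := X) ▸ Subgroup.mem_top v
    induction hv using Subgroup.closure_induction with
    | mem v hv =>
      obtain ⟨y, rfl⟩ := hv
      intro g
      rw [hF, toAffine_shift_left]
    | one => simp
    | mul v w _ _ hv hw => intro g; rw [map_mul, Equiv.Perm.mul_apply, hv, hw, mul_assoc]
    | inv v _ hv =>
      intro g
      rw [eq_inv_mul_iff_mul_eq, ← hv, map_inv, Equiv.Perm.inv_def, Equiv.apply_symm_apply]
  have hright : ∀ g, F (h.toAffine g).left 1 = g := by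
    have hstep : ∀ g x, F (h.toAffine (g * PresentedGroup.of x)).left 1 =
        h.shift (h.toPerm g x) (F (h.toAffine g).left 1) := by
      intro g x
      rw [toAffine_mul_of_left, mul_comm, map_mul, hF, Equiv.Perm.mul_apply]
    intro g
    have hg : g ∈ Subgroup.closure (Set.range PresentedGroup.of) :=
      PresentedGroup.closure_range_of (structRels r) ▸ Subgroup.mem_top g
    induction hg using Subgroup.closure_induction_right with
    | one => simp
    | mul_right g _ x hx ih =>
      obtain ⟨x, rfl⟩ := hx
      rw [hstep, ih, shift_toPerm_apply]
    | mul_inv_cancel g _ x hx ih =>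
      obtain ⟨x, rfl⟩ := hx
      have := hstep (g * (PresentedGroup.of x)⁻¹) x
      rw [inv_mul_cancel_right, ih] at this
      refine (h.shift (h.toPerm (g * (PresentedGroup.of x)⁻¹) x)).injective ?_
      rw [← this, shift_toPerm_apply, inv_mul_cancel_right]
  refine ⟨Function.LeftInverse.injective (g := fun v => F v 1) hright,
    fun v => ⟨F v 1, ?_⟩⟩
  simp [hleft]

theorem toAffine_eq_inl {g : PresentedGroup (structRels r)} (hg : h.toPerm g = 1) :
    h.toAffine g = SemidirectProduct.inl (h.toAffine g).left :=
  SemidirectProduct.ext rfl hg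

theorem toAffine_of_pow (x : X) (n : ℕ) :
    h.toAffine (PresentedGroup.of x ^ n) = ⟨basisVec x ^ n, h.lperm x ^ n⟩ := by
  induction n with
  | zero => simp
  | succ n ih =>
    rw [pow_succ', map_mul, ih, toAffine_of, SemidirectProduct.mul_def, map_pow,
      mulAutArrow_basisVec, lperm_self, pow_succ', pow_succ']

theorem ker_toPerm_comm [Finite X] (a : PresentedGroup (structRels r)) (ha : a ∈ h.toPerm.ker)
    (b : PresentedGroup (structRels r)) (hb : b ∈ h.toPerm.ker) : a * b = b * a := by
  apply h.bijective_toAffine_left.injective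
  simp only [map_mul]
  rw [h.toAffine_eq_inl ha, h.toAffine_eq_inl hb, ← map_mul, ← map_mul, mul_comm]

theorem toAffine_of_pow_card [Finite X] (x : X) :
    h.toAffine (PresentedGroup.of x ^ Nat.card (Equiv.Perm X)) =
      SemidirectProduct.inl (basisVec x ^ Nat.card (Equiv.Perm X)) := by
  rw [toAffine_of_pow, pow_card_eq_one']
  rfl

theorem toPerm_eq_one_of_left_eq_pow_card [Finite X] {g : PresentedGroup (structRels r)}
    {v : X → Multiplicative ℤ} (hg : (h.toAffine g).left = v ^ Nat.card (Equiv.Perm X)) :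
    h.toPerm g = 1 := by
  have hK : Subgroup.closure (Set.range basisVec) ≤
      (h.toAffine.range.comap SemidirectProduct.inl).comap
        (powMonoidHom (Nat.card (Equiv.Perm X))) := by
    rw [Subgroup.closure_le]
    rintro _ ⟨x, rfl⟩
    exact ⟨_, h.toAffine_of_pow_card x⟩
  rw [closure_range_basisVec] at hK
  obtain ⟨g', hg'⟩ := hK (Subgroup.mem_top v)
  have hgg : g = g' := h.bijective_toAffine_left.injective (by
    simp only [hg, hg', SemidirectProduct.left_inl, powMonoidHom_apply])
  rw [hgg]
  exact congrArg SemidirectProduct.right hg'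

/-- Reduction of the lattice `ℤ^X` modulo `n`. -/
def reduceMod (X : Type*) (n : ℕ) : (X → Multiplicative ℤ) →* (X → Multiplicative (ZMod n)) :=
  (Int.castAddHom (ZMod n)).toMultiplicative.compLeft X

theorem reduceMod_surjective (n : ℕ) : Function.Surjective (reduceMod X n) :=
  (ZMod.intCast_surjective (n := n)).comp_left

theorem exists_eq_pow_of_reduceMod_eq_one {n : ℕ} {v : X → Multiplicative ℤ}
    (hv : reduceMod X n v = 1) : ∃ w, v = w ^ n := by
  have hdvd : ∀ x, ∃ k : ℤ, (v x).toAdd = n * k := fun x =>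
    (ZMod.intCast_zmod_eq_zero_iff_dvd _ n).1 (congrFun hv x)
  choose w hw using hdvd
  refine ⟨fun x => Multiplicative.ofAdd (w x), funext fun x => ?_⟩
  rw [Pi.pow_apply, ← ofAdd_nsmul, nsmul_eq_mul, ← hw, ofAdd_toAdd]

/-- The composition of `toAffine` with reduction of the lattice modulo `n`. -/
noncomputable def toAffineMod (n : ℕ) : PresentedGroup (structRels r) →*
    (X → Multiplicative (ZMod n)) ⋊[mulAutArrow] Equiv.Perm X :=
  (SemidirectProduct.map (reduceMod X n) (MonoidHom.id _) fun _ => rfl).comp h.toAffine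

theorem isSolvable_range_toPerm [Finite X] : Group.IsSolvable h.toPerm.range := by
  let N := Nat.card (Equiv.Perm X)
  have : NeZero N := ⟨Nat.card_pos.ne'⟩
  have : Finite (Multiplicative (ZMod N)) := inferInstanceAs (Finite (ZMod N))
  have : Finite ((X → Multiplicative (ZMod N)) ⋊[mulAutArrow] Equiv.Perm X) :=
    Finite.of_equiv _ SemidirectProduct.equivProd.symm
  have hone : ∀ g, (h.toAffineMod N g).left = 1 → h.toAffineMod N g = 1 := by
    intro g hg
    obtain ⟨w, hw⟩ := exists_eq_pow_of_reduceMod_eq_one hg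
    exact SemidirectProduct.ext hg (h.toPerm_eq_one_of_left_eq_pow_card hw)
  have hsol : Group.IsSolvable (h.toAffineMod N).range := by
    refine isSolvable_of_bijective_cocycle
      (mulAutArrow.comp (SemidirectProduct.rightHom.comp (h.toAffineMod N).range.subtype))
      (fun g => g.1.left) ⟨?_, fun v => ?_⟩ fun _ _ => rfl
    · rintro ⟨_, a, rfl⟩ ⟨_, b, rfl⟩ hab
      have hab' : (h.toAffineMod N a).left = (h.toAffineMod N b).left := hab
      have := hone (a⁻¹ * b) (by
        rw [map_mul, map_inv, SemidirectProduct.mul_left, SemidirectProduct.inv_left,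
          SemidirectProduct.inv_right, ← hab', ← map_mul, inv_mul_cancel, map_one])
      rw [map_mul, map_inv, inv_mul_eq_one] at this
      exact Subtype.ext this
    · obtain ⟨u, rfl⟩ := reduceMod_surjective N v
      obtain ⟨g, rfl⟩ := h.bijective_toAffine_left.surjective u
      exact ⟨⟨_, g, rfl⟩, rfl⟩
  have hrange : h.toPerm.range = (h.toAffineMod N).range.map SemidirectProduct.rightHom := by
    rw [MonoidHom.map_range]
    rfl
  rw [hrange]
  exact Group.isSolvable_of_surjective
    (SemidirectProduct.rightHom.subgroupMap_surjective (h.toAffineMod N).range)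

theorem basisVec_pow_injective {n : ℕ} (hn : n ≠ 0) :
    Function.Injective fun x : X => basisVec x ^ n := by
  classical
  intro x y hxy
  by_contra hne
  have := congrFun hxy x
  simp only [basisVec, Pi.pow_apply, Pi.mulSingle_eq_same, Pi.mulSingle_eq_of_ne hne, one_pow,
    ← ofAdd_nsmul] at this
  simp [hn] at this

theorem exists_mem_derivedSeries [Finite X] {n : ℕ} {g : PresentedGroup (structRels r)}
    (hg : g ∈ derivedSeries _ n) (hg1 : h.toPerm g ≠ 1) {k : ℕ} (hk : k ≤ n + 1) :
    ∃ a ∈ derivedSeries (PresentedGroup (structRels r)) k, ∃ v,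
      h.toAffine a = SemidirectProduct.inl v ∧ mulAutArrow (h.toPerm g) v ≠ v := by
  induction k with
  | zero =>
    obtain ⟨x, hx⟩ : ∃ x, h.toPerm g x ≠ x := by
      by_contra! hall
      exact hg1 (Equiv.ext hall)
    refine ⟨_, Subgroup.mem_top _, _, h.toAffine_of_pow_card x, fun heq => hx ?_⟩
    rw [map_pow, mulAutArrow_basisVec] at heq
    exact basisVec_pow_injective Nat.card_pos.ne' heq
  | succ k ih =>
    obtain ⟨a, ha, v, hav, hv⟩ := ih (by omega)
    refine ⟨g * a * g⁻¹ * a⁻¹, Subgroup.commutator_mem_commutator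
      (derivedSeries_antitone _ (by omega : k ≤ n) hg) ha, _, ?_,
      MulAut.map_div_ne_of_map_ne ?_ hv⟩
    · simp only [map_mul, map_inv, hav]
      ext1
      · simp [toPerm, div_eq_mul_inv]
      · simp [div_eq_mul_inv]
    · exact MonoidHom.isOfFinOrder mulAutArrow (isOfFinOrder_of_finite (h.toPerm g))

theorem derivedSeries_ne_bot [Finite X] [Nontrivial X] {n : ℕ}
    (hn : ∀ k < n, derivedSeries h.toPerm.range k ≠ ⊥) :
    derivedSeries (PresentedGroup (structRels r)) n ≠ ⊥ := by
  suffices ∃ a ∈ derivedSeries (PresentedGroup (structRels r)) n, h.toAffine a ≠ 1 by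
    obtain ⟨a, ha, ha1⟩ := this
    intro hbot
    rw [hbot, Subgroup.mem_bot] at ha
    exact ha1 (ha ▸ map_one _)
  cases n with
  | zero =>
    obtain ⟨x, y, hxy⟩ := exists_pair_ne X
    by_contra! hall
    have := h.bijective_toAffine_left.surjective
    obtain ⟨a, ha⟩ := this (basisVec x)
    obtain ⟨b, hb⟩ := this (basisVec y)
    simp only [hall _ (Subgroup.mem_top _)] at ha hb
    exact hxy (basisVec_pow_injective one_ne_zero (by simp [← ha, ← hb]))
  | succ n =>
    obtain ⟨⟨σ, hσ⟩, hσ1⟩ := Subgroup.ne_bot_iff_exists_ne_one.1 (hn n n.lt_succ_self)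
    rw [← map_derivedSeries_eq h.toPerm.rangeRestrict_surjective] at hσ
    obtain ⟨g, hg, rfl⟩ := hσ
    have hg1 : h.toPerm g ≠ 1 := fun hg1 => hσ1 (Subtype.ext (Subtype.ext hg1))
    obtain ⟨a, ha, v, hav, hv⟩ := h.exists_mem_derivedSeries hg hg1 le_rfl
    refine ⟨a, ha, fun ha1 => hv ?_⟩
    rw [hav, map_eq_one_iff _ SemidirectProduct.inl_injective] at ha1
    rw [ha1, map_one]

end IsSquareFreeSolution

/-- for a finite square-free solution on a nontrivial set,
`sol(G(X,r)) = sol(𝒢(X,r)) + 1`. -/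
theorem stmt13 {X : Type*} [Finite X] [Nontrivial X] (r : X × X → X × X)
    (h : IsSquareFreeSolution r) :
    solLength (PresentedGroup (structRels r)) = solLength (↥(Gcal r)) + 1 := by
  rw [← h.range_toPerm]
  have hsol : derivedSeries h.toPerm.range (solLength h.toPerm.range) = ⊥ :=
    Nat.sInf_mem (s := {n | derivedSeries h.toPerm.range n = ⊥}) h.isSolvable_range_toPerm.solvable
  refine solLength_eq_succ _ _ (derivedSeries_succ_eq_bot_of_ker_comm h.toPerm.rangeRestrict ?_ hsol)
    (h.derivedSeries_ne_bot fun k hk => Nat.notMem_of_lt_sInf hk)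
  rw [MonoidHom.ker_rangeRestrict]
  exact h.ker_toPerm_comm

end YBPaper
end
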